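/- For m, d, r^{-1}, τ, λ all strictly positive, the impulse response \tilde{h}(t) of the third-order transfer function (τs+1)/(mτs³ + (m+dτ)s² + (d + r^{-1} + λτ)s + λ) has squared L² norm ‖\tilde{h}‖² = (m + τ(λτ + d)) / (2λ[m(r^{-1}+d) + τd(r^{-1} + λτ + d)]). -/

import Mathlib

open MeasureTheory Set
open Filter Topology

theorem ae_eq_zero_of_forall_integral_mul_exp_eq_zero {μ : Measure ℝ} [SigmaFinite μ] {f : ℝ → ℝ}
    (hf : Integrable f μ)
    (h : ∀ ω : ℝ, ∫ t, (f t : ℂ) * Complex.exp (ω * t * Complex.I) ∂μ = 0) :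
    f =ᵐ[μ] 0 := by
  have hp := hf.aemeasurable.ennreal_ofReal
  have hn := hf.neg.aemeasurable.ennreal_ofReal
  have := isFiniteMeasure_withDensity_ofReal hf.2
  have := isFiniteMeasure_withDensity_ofReal hf.neg.2
  have hexp (ω : ℝ) {g : ℝ → ℝ} (hg : Integrable g μ) :
      Integrable (fun t ↦ (g t : ℂ) * Complex.exp (ω * t * Complex.I)) μ := by
    refine hg.ofReal.mul_bdd (c := 1) (by fun_prop) (ae_of_all _ fun t ↦ ?_)
    rw [← Complex.ofReal_mul, Complex.norm_exp_ofReal_mul_I]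
  have key : μ.withDensity (fun t ↦ ENNReal.ofReal (f t)) =
      μ.withDensity (fun t ↦ ENNReal.ofReal ((-f) t)) := by
    refine Measure.ext_of_charFun (funext fun ω ↦ ?_)
    rw [charFun_apply_real, charFun_apply_real,
      integral_withDensity_eq_integral_toReal_smul₀ hp (by simp),
      integral_withDensity_eq_integral_toReal_smul₀ hn (by simp), ← sub_eq_zero]
    simp only [ENNReal.toReal_ofReal', Complex.real_smul, Pi.neg_apply]
    rw [← integral_sub (hexp ω hf.pos_part) (hexp ω hf.neg_part), ← h ω]
    congr with t
    rw [← sub_mul, ← Complex.ofReal_sub]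
    congr 2
    exact max_zero_sub_eq_self (f t)
  rw [withDensity_eq_iff_of_sigmaFinite hp hn] at key
  filter_upwards [key] with t ht
  rcases le_total (f t) 0 with h0 | h0
  · rw [ENNReal.ofReal_of_nonpos h0, eq_comm, ENNReal.ofReal_eq_zero] at ht
    simp at ht ⊢
    linarith
  · rw [ENNReal.ofReal_of_nonpos (p := (-f) t) (by simpa using h0), ENNReal.ofReal_eq_zero] at ht
    simp
    linarith

theorem integrableOn_mul_cexp_neg_of_tendsto_zero {u : ℝ → ℝ} (hu : Continuous u)
    (h0 : Tendsto u atTop (𝓝 0)) {s : ℂ} (hs : 0 < s.re) :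
    IntegrableOn (fun t : ℝ ↦ (u t : ℂ) * Complex.exp (-s * t)) (Ioi 0) := by
  have hc : Continuous fun t : ℝ ↦ (u t : ℂ) * Complex.exp (-s * t) := by fun_prop
  rw [IntegrableOn, ← integrable_norm_iff hc.aestronglyMeasurable]
  refine integrable_of_isBigO_exp_neg hs hc.norm.continuousOn ?_
  have : (fun t : ℝ ↦ ‖(u t : ℂ) * Complex.exp (-s * t)‖) =
      fun t ↦ |u t| * Real.exp (-s.re * t) := by
    ext t
    simp [Complex.norm_exp]
  rw [this]
  simpa using ((h0.abs.isBigO_one ℝ).mul (Asymptotics.isBigO_refl (fun t ↦ Real.exp (-s.re * t)) _))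

theorem integral_deriv_mul_cexp_neg {u v : ℝ → ℝ} (hu : ∀ t, HasDerivAt u (v t) t)
    (hv : Continuous v) (hu0 : Tendsto u atTop (𝓝 0)) (hv0 : Tendsto v atTop (𝓝 0))
    {s : ℂ} (hs : 0 < s.re) :
    ∫ t in Ioi (0 : ℝ), (v t : ℂ) * Complex.exp (-s * t) =
      s * (∫ t in Ioi (0 : ℝ), (u t : ℂ) * Complex.exp (-s * t)) - u 0 := by
  have huc : Continuous u := continuous_iff_continuousAt.2 fun t ↦ (hu t).continuousAt
  have hui := integrableOn_mul_cexp_neg_of_tendsto_zero huc hu0 hs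
  have hvi := integrableOn_mul_cexp_neg_of_tendsto_zero hv hv0 hs
  have hd (t : ℝ) : HasDerivAt (fun t : ℝ ↦ (u t : ℂ) * Complex.exp (-s * t))
      ((v t : ℂ) * Complex.exp (-s * t) - s * ((u t : ℂ) * Complex.exp (-s * t))) t := by
    have h1 : HasDerivAt (fun t : ℝ ↦ Complex.exp (-s * t)) (Complex.exp (-s * t) * (-s * 1)) t :=
      ((Complex.ofRealCLM.hasDerivAt (x := t)).const_mul (-s)).cexp
    convert! (hu t).ofReal_comp.mul h1 using 1
    ring
  have hlim : Tendsto (fun t : ℝ ↦ (u t : ℂ) * Complex.exp (-s * t)) atTop (𝓝 0) := by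
    rw [tendsto_zero_iff_norm_tendsto_zero]
    refine squeeze_zero' (Eventually.of_forall fun t ↦ norm_nonneg _) ?_ (by simpa using hu0.abs)
    filter_upwards [eventually_ge_atTop 0] with t ht
    rw [norm_mul, Complex.norm_real, Real.norm_eq_abs, Complex.norm_exp]
    refine mul_le_of_le_one_right (abs_nonneg _) (Real.exp_le_one_iff.2 ?_)
    simp
    positivity
  have := integral_Ioi_of_hasDerivAt_of_tendsto' (fun t _ ↦ hd t) (hvi.sub (hui.const_mul s)) hlim
  rw [integral_sub hvi (hui.const_mul s), integral_const_mul] at this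
  simp only [Complex.ofReal_zero, mul_zero, Complex.exp_zero, mul_one] at this
  linear_combination this

/-- Every third-order linear initial value problem with constant coefficients has a global
solution. -/
theorem exists_linear_ode_third_order (a b c x₀ y₀ z₀ : ℝ) :
    ∃ x y z : ℝ → ℝ, (∀ t, HasDerivAt x (y t) t) ∧ (∀ t, HasDerivAt y (z t) t) ∧
      (∀ t, HasDerivAt z (-(a * z t + b * y t + c * x t)) t) ∧
      x 0 = x₀ ∧ y 0 = y₀ ∧ z 0 = z₀ := by
  let A : (Fin 3 → ℝ) →L[ℝ] (Fin 3 → ℝ) :=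
    (Matrix.toLin' !![0, 1, 0; 0, 0, 1; -c, -b, -a]).toContinuousLinearMap
  let X : ℝ → Fin 3 → ℝ := fun t ↦ NormedSpace.exp (t • A) ![x₀, y₀, z₀]
  have hX (t : ℝ) : HasDerivAt X (A (X t)) t :=
    (hasDerivAt_exp_smul_const' A t).clm_apply (hasDerivAt_const t ![x₀, y₀, z₀]) |>.congr_deriv
      (by simp [X])
  have hXi (t : ℝ) := hasDerivAt_pi.1 (hX t)
  refine ⟨fun t ↦ X t 0, fun t ↦ X t 1, fun t ↦ X t 2, fun t ↦ ?_, fun t ↦ ?_, fun t ↦ ?_,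
    ?_, ?_, ?_⟩
  · convert! hXi t 0 using 1
    simp [A, Matrix.mulVec, dotProduct, Fin.sum_univ_three]
  · convert! hXi t 1 using 1
    simp [A, Matrix.mulVec, dotProduct, Fin.sum_univ_three]
  · convert! hXi t 2 using 1
    simp [A, Matrix.mulVec, dotProduct, Fin.sum_univ_three]
    ring
  all_goals simp [X]

theorem tendsto_zero_of_lyapunov {N U U' : ℝ → ℝ} {C κ : ℝ} (hC : 0 < C) (hκ : 0 < κ)
    (hU : ∀ t, HasDerivAt U (U' t) t) (hN : ∀ t, 0 ≤ N t) (hNU : ∀ t, N t ≤ U t)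
    (hUN : ∀ t, U t ≤ C * N t) (hU' : ∀ t, U' t ≤ -κ * N t) :
    Tendsto N atTop (𝓝 0) := by
  have hd (t : ℝ) : HasDerivAt (fun t ↦ Real.exp (κ / C * t) * U t)
      (Real.exp (κ / C * t) * (κ / C * 1) * U t + Real.exp (κ / C * t) * U' t) t :=
    ((hasDerivAt_id t).const_mul (κ / C)).exp.mul (hU t)
  have hanti : Antitone fun t ↦ Real.exp (κ / C * t) * U t := by
    refine antitone_of_hasDerivAt_nonpos hd fun t ↦ ?_
    have h1 : κ / C * U t ≤ κ * N t := by
      calc κ / C * U t ≤ κ / C * (C * N t) := by gcongr; exact hUN t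
        _ = κ * N t := by field_simp
    have h2 : κ / C * U t + U' t ≤ 0 := by linarith [hU' t]
    have h3 := mul_nonpos_of_nonneg_of_nonpos (Real.exp_pos (κ / C * t)).le h2
    simp only [Pi.zero_apply]
    linarith
  have hlim : Tendsto (fun t ↦ Real.exp (-(κ / C * t)) * U 0) atTop (𝓝 0) := by
    have : Tendsto (fun t ↦ κ / C * t) atTop atTop :=
      tendsto_id.const_mul_atTop (by positivity)
    simpa using (Real.tendsto_exp_neg_atTop_nhds_zero.comp this).mul_const (U 0)
  refine squeeze_zero' (Eventually.of_forall hN) ?_ hlim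
  filter_upwards [eventually_ge_atTop 0] with t ht
  refine (hNU t).trans ?_
  have := hanti ht
  simp only [mul_zero, Real.exp_zero, one_mul] at this
  rw [Real.exp_neg, inv_mul_eq_div, le_div_iff₀ (Real.exp_pos _)]
  linarith

section ThirdOrder

variable {a b c : ℝ} {x y z : ℝ → ℝ}

theorem hasDerivAt_schwarz_form (hx : ∀ t, HasDerivAt x (y t) t) (hy : ∀ t, HasDerivAt y (z t) t)
    (hz : ∀ t, HasDerivAt z (-(a * z t + b * y t + c * x t)) t) (t : ℝ) :
    HasDerivAt (fun t ↦ (z t + a * y t) ^ 2 + b * y t ^ 2 + 2 * c * (x t * y t) + a * c * x t ^ 2)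
      (-2 * (a * b - c) * y t ^ 2) t := by
  refine ((((((hz t).add ((hy t).const_mul a)).pow 2).add (((hy t).pow 2).const_mul b)).add
    (((hx t).mul (hy t)).const_mul (2 * c))).add (((hx t).pow 2).const_mul (a * c))).congr_deriv ?_
  simp
  ring

theorem hasDerivAt_position_form (hx : ∀ t, HasDerivAt x (y t) t) (hy : ∀ t, HasDerivAt y (z t) t)
    (hz : ∀ t, HasDerivAt z (-(a * z t + b * y t + c * x t)) t) (t : ℝ) :
    HasDerivAt (fun t ↦ x t * z t + a * (x t * y t) + b / 2 * x t ^ 2 - 1 / 2 * y t ^ 2)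
      (-c * x t ^ 2 + a * y t ^ 2) t := by
  refine (((((hx t).mul (hz t)).add (((hx t).mul (hy t)).const_mul a)).add
    (((hx t).pow 2).const_mul (b / 2))).sub (((hy t).pow 2).const_mul (1 / 2))).congr_deriv ?_
  simp
  ring

theorem hasDerivAt_acceleration_form (hx : ∀ t, HasDerivAt x (y t) t)
    (hy : ∀ t, HasDerivAt y (z t) t)
    (hz : ∀ t, HasDerivAt z (-(a * z t + b * y t + c * x t)) t) (t : ℝ) :
    HasDerivAt (fun t ↦ -(y t * z t) - a / 2 * y t ^ 2 - c / 2 * x t ^ 2)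
      (-z t ^ 2 + b * y t ^ 2) t := by
  refine ((((hy t).mul (hz t)).neg.sub (((hy t).pow 2).const_mul (a / 2))).sub
    (((hx t).pow 2).const_mul (c / 2))).congr_deriv ?_
  simp
  ring

theorem exists_le_mul_schwarz_form (ha : 0 < a) (hb : 0 < b) (hc : 0 < c) (hab : c < a * b) :
    ∃ M > 0, ∀ x y z : ℝ, x ^ 2 + y ^ 2 + z ^ 2 ≤
      M * ((z + a * y) ^ 2 + b * y ^ 2 + 2 * c * (x * y) + a * c * x ^ 2) := by
  have hδ : 0 < a * b - c := sub_pos.2 hab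
  set κ := c * (a * b - c) / b with hκ
  have hκ0 : 0 < κ := by positivity
  refine ⟨2 + (1 + 2 * a ^ 2) * 2 / b + (1 + (1 + 2 * a ^ 2) * 2 * (c / b) ^ 2) / κ, by positivity,
    fun x y z ↦ ?_⟩
  set w := z + a * y with hw
  set v := y + c / b * x with hv
  have hS : w ^ 2 + b * y ^ 2 + 2 * c * (x * y) + a * c * x ^ 2 =
      w ^ 2 + b * v ^ 2 + κ * x ^ 2 := by
    rw [hv, hκ]
    field_simp
    ring
  rw [hS]
  have hw2 : w ^ 2 ≤ w ^ 2 + b * v ^ 2 + κ * x ^ 2 := by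
    have : 0 ≤ b * v ^ 2 + κ * x ^ 2 := by positivity
    linarith
  have hv2 : b * v ^ 2 ≤ w ^ 2 + b * v ^ 2 + κ * x ^ 2 := by
    have : 0 ≤ w ^ 2 + κ * x ^ 2 := by positivity
    linarith
  have hx2 : κ * x ^ 2 ≤ w ^ 2 + b * v ^ 2 + κ * x ^ 2 := by
    have : 0 ≤ w ^ 2 + b * v ^ 2 := by positivity
    linarith
  set S := w ^ 2 + b * v ^ 2 + κ * x ^ 2
  have hy2 : y ^ 2 ≤ 2 * v ^ 2 + 2 * ((c / b) ^ 2 * x ^ 2) := by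
    have : y = v - c / b * x := by rw [hv]; ring
    rw [this]
    nlinarith [sq_nonneg (v + c / b * x)]
  have hz2 : z ^ 2 ≤ 2 * w ^ 2 + 2 * a ^ 2 * y ^ 2 := by
    have : z = w - a * y := by rw [hw]; ring
    rw [this]
    nlinarith [sq_nonneg (w + a * y)]
  calc x ^ 2 + y ^ 2 + z ^ 2
      ≤ x ^ 2 + (2 * w ^ 2 + (1 + 2 * a ^ 2) * y ^ 2) := by linarith
    _ ≤ x ^ 2 + (2 * w ^ 2 + (1 + 2 * a ^ 2) * (2 * v ^ 2 + 2 * ((c / b) ^ 2 * x ^ 2))) := by gcongr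
    _ = 2 * w ^ 2 + (1 + 2 * a ^ 2) * 2 / b * (b * v ^ 2)
        + (1 + (1 + 2 * a ^ 2) * 2 * (c / b) ^ 2) / κ * (κ * x ^ 2) := by
      field_simp
      ring
    _ ≤ 2 * S + (1 + 2 * a ^ 2) * 2 / b * S
        + (1 + (1 + 2 * a ^ 2) * 2 * (c / b) ^ 2) / κ * S := by gcongr
    _ = _ := by ring

theorem abs_quadratic_form_le (p q r u v w x y z : ℝ) :
    |p * x ^ 2 + q * y ^ 2 + r * z ^ 2 + u * (x * y) + v * (y * z) + w * (x * z)| ≤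
      (|p| + |q| + |r| + |u| + |v| + |w|) * (x ^ 2 + y ^ 2 + z ^ 2) := by
  have hN : 0 ≤ x ^ 2 + y ^ 2 + z ^ 2 := by positivity
  have key (k e : ℝ) (he : |e| ≤ x ^ 2 + y ^ 2 + z ^ 2) :
      |k * e| ≤ |k| * (x ^ 2 + y ^ 2 + z ^ 2) := by
    rw [abs_mul]
    gcongr
  have h1 := key p (x ^ 2) (by rw [abs_of_nonneg (sq_nonneg _)]; nlinarith)
  have h2 := key q (y ^ 2) (by rw [abs_of_nonneg (sq_nonneg _)]; nlinarith)
  have h3 := key r (z ^ 2) (by rw [abs_of_nonneg (sq_nonneg _)]; nlinarith)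
  have h4 := key u (x * y) <| by
    rw [abs_le]; constructor <;> nlinarith [sq_nonneg (x - y), sq_nonneg (x + y)]
  have h5 := key v (y * z) <| by
    rw [abs_le]; constructor <;> nlinarith [sq_nonneg (y - z), sq_nonneg (y + z)]
  have h6 := key w (x * z) <| by
    rw [abs_le]; constructor <;> nlinarith [sq_nonneg (x - z), sq_nonneg (x + z)]
  rw [abs_le] at *
  constructor <;> linarith [h1.1, h1.2, h2.1, h2.2, h3.1, h3.2, h4.1, h4.2, h5.1, h5.2, h6.1, h6.2]

theorem tendsto_zero_of_third_order_hurwitz (ha : 0 < a) (hb : 0 < b) (hc : 0 < c)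
    (hab : c < a * b)
    (hx : ∀ t, HasDerivAt x (y t) t) (hy : ∀ t, HasDerivAt y (z t) t)
    (hz : ∀ t, HasDerivAt z (-(a * z t + b * y t + c * x t)) t) :
    Tendsto x atTop (𝓝 0) ∧ Tendsto y atTop (𝓝 0) ∧ Tendsto z atTop (𝓝 0) := by
  obtain ⟨M, hM, hMS⟩ := exists_le_mul_schwarz_form ha hb hc hab
  have hδ : 0 < a * b - c := sub_pos.2 hab
  have hT (t : ℝ) := abs_le.1 <| abs_quadratic_form_le (b / 2 - c / 2) (-(1 / 2) - a / 2) 0 a (-1) 1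
    (x t) (y t) (z t)
  set C₁ : ℝ := |b / 2 - c / 2| + |-(1 / 2) - a / 2| + |0| + |a| + |-1| + |1|
  have hC₁ : 0 ≤ C₁ := by positivity
  set K : ℝ := M * (C₁ + 1) + (a + b + 1) / (2 * (a * b - c)) with hK
  have hK0 : 0 < K := by positivity
  have hS (t : ℝ) := abs_le.1 <| abs_quadratic_form_le (a * c) (a ^ 2 + b) 1 (2 * c) (2 * a) 0
    (x t) (y t) (z t)
  set C₂ : ℝ := |a * c| + |a ^ 2 + b| + |1| + |2 * c| + |2 * a| + |0|
  have hC₂ : 0 < C₂ := by positivity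
  have hlim : Tendsto (fun t ↦ x t ^ 2 + y t ^ 2 + z t ^ 2) atTop (𝓝 0) := by
    refine tendsto_zero_of_lyapunov (C := C₁ + K * C₂) (κ := min c 1) (by positivity)
      (by positivity)
      (fun t ↦ ((hasDerivAt_position_form hx hy hz t).add
        (hasDerivAt_acceleration_form hx hy hz t)).add
        ((hasDerivAt_schwarz_form hx hy hz t).const_mul K))
      (fun t ↦ by positivity) (fun t ↦ ?_) (fun t ↦ ?_) (fun t ↦ ?_)
    · have h1 := (hT t).1
      have h2 : (C₁ + 1) * (x t ^ 2 + y t ^ 2 + z t ^ 2) ≤ K * ((z t + a * y t) ^ 2 + b * y t ^ 2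
          + 2 * c * (x t * y t) + a * c * x t ^ 2) := by
        have h3 := hMS (x t) (y t) (z t)
        have h4 : 0 ≤ (z t + a * y t) ^ 2 + b * y t ^ 2
            + 2 * c * (x t * y t) + a * c * x t ^ 2 :=
          nonneg_of_mul_nonneg_right (le_trans (by positivity) h3) hM
        have h5 : M * (C₁ + 1) ≤ K := le_add_of_nonneg_right (by positivity)
        have h6 := mul_le_mul_of_nonneg_left h3 (by positivity : 0 ≤ C₁ + 1)
        have h7 := mul_le_mul_of_nonneg_right h5 h4
        linarith
      simp only [Pi.add_apply]
      linarith
    · have h1 := (hT t).2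
      have h2 := mul_le_mul_of_nonneg_left (hS t).2 hK0.le
      simp only [Pi.add_apply]
      linarith
    · have h1 : a + b + 1 ≤ 2 * (a * b - c) * K := by
        have : 2 * (a * b - c) * K = 2 * (a * b - c) * (M * (C₁ + 1)) + (a + b + 1) := by
          rw [hK]
          field_simp
        rw [this]
        have : 0 ≤ 2 * (a * b - c) * (M * (C₁ + 1)) := by positivity
        linarith
      have h2 := mul_le_mul_of_nonneg_right h1 (sq_nonneg (y t))
      have h3 := mul_le_mul_of_nonneg_right (min_le_left c 1) (sq_nonneg (x t))
      have h4 := mul_le_mul_of_nonneg_right (min_le_right c 1) (sq_nonneg (y t))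
      have h5 := mul_le_mul_of_nonneg_right (min_le_right c 1) (sq_nonneg (z t))
      linarith
  have key {f : ℝ → ℝ} (hf : ∀ t, f t ^ 2 ≤ x t ^ 2 + y t ^ 2 + z t ^ 2) :
      Tendsto f atTop (𝓝 0) := by
    have h2 : Tendsto (fun t ↦ f t ^ 2) atTop (𝓝 0) :=
      squeeze_zero (fun t ↦ sq_nonneg _) hf hlim
    rw [tendsto_zero_iff_abs_tendsto_zero]
    simpa [Function.comp_def, Real.sqrt_sq_eq_abs] using h2.sqrt
  refine ⟨key fun t ↦ ?_, key fun t ↦ ?_, key fun t ↦ ?_⟩ <;>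
    nlinarith [sq_nonneg (x t), sq_nonneg (y t), sq_nonneg (z t)]

theorem integral_sq_third_order (ha : 0 < a) (hb : 0 < b) (hc : 0 < c)
    (hab : c < a * b)
    (hx : ∀ t, HasDerivAt x (y t) t) (hy : ∀ t, HasDerivAt y (z t) t)
    (hz : ∀ t, HasDerivAt z (-(a * z t + b * y t + c * x t)) t)
    (hx0 : x 0 = 0) (hy0 : y 0 = 0) (τ : ℝ) :
    ∫ t in Ioi (0 : ℝ), (τ * y t + x t) ^ 2 = (a / c + τ ^ 2) / (2 * (a * b - c)) * z 0 ^ 2 := by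
  obtain ⟨hxl, hyl, hzl⟩ := tendsto_zero_of_third_order_hurwitz ha hb hc hab hx hy hz
  have hδ : 0 < a * b - c := sub_pos.2 hab
  set V : ℝ → ℝ := fun t ↦ τ * x t ^ 2
    - 1 / c * (x t * z t + a * (x t * y t) + b / 2 * x t ^ 2 - 1 / 2 * y t ^ 2)
    - (a / c + τ ^ 2) / (2 * (a * b - c)) *
      ((z t + a * y t) ^ 2 + b * y t ^ 2 + 2 * c * (x t * y t) + a * c * x t ^ 2) with hV
  have hd (t : ℝ) : HasDerivAt V ((τ * y t + x t) ^ 2) t := by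
    refine (((((hx t).pow 2).const_mul τ).sub
      ((hasDerivAt_position_form hx hy hz t).const_mul (1 / c))).sub
      ((hasDerivAt_schwarz_form hx hy hz t).const_mul _)).congr_deriv ?_
    simp
    field_simp
    ring
  have hl : Tendsto V atTop (𝓝 0) := by
    have := (((hxl.pow 2).const_mul τ).sub (((((hxl.mul hzl).add ((hxl.mul hyl).const_mul a)).add
      ((hxl.pow 2).const_mul (b / 2))).sub ((hyl.pow 2).const_mul (1 / 2))).const_mul (1 / c))).sub
      ((((((hzl.add (hyl.const_mul a)).pow 2).add ((hyl.pow 2).const_mul b)).add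
      ((hxl.mul hyl).const_mul (2 * c))).add ((hxl.pow 2).const_mul (a * c))).const_mul
      ((a / c + τ ^ 2) / (2 * (a * b - c))))
    simpa [hV] using this
  rw [integral_Ioi_of_hasDerivAt_of_nonneg' (fun t _ ↦ hd t) (fun t _ ↦ sq_nonneg _) hl]
  simp [hV, hx0, hy0]

theorem integral_mul_cexp_neg_third_order (ha : 0 < a) (hb : 0 < b) (hc : 0 < c)
    (hab : c < a * b)
    (hx : ∀ t, HasDerivAt x (y t) t) (hy : ∀ t, HasDerivAt y (z t) t)
    (hz : ∀ t, HasDerivAt z (-(a * z t + b * y t + c * x t)) t)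
    (hx0 : x 0 = 0) (hy0 : y 0 = 0) (τ : ℝ) {s : ℂ} (hs : 0 < s.re) :
    (∫ t in Ioi (0 : ℝ), ((τ * y t + x t : ℝ) : ℂ) * Complex.exp (-s * t)) *
      (s ^ 3 + a * s ^ 2 + b * s + c) = (τ * s + 1) * z 0 := by
  obtain ⟨hxl, hyl, hzl⟩ := tendsto_zero_of_third_order_hurwitz ha hb hc hab hx hy hz
  have hxc : Continuous x := continuous_iff_continuousAt.2 fun t ↦ (hx t).continuousAt
  have hyc : Continuous y := continuous_iff_continuousAt.2 fun t ↦ (hy t).continuousAt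
  have hzc : Continuous z := continuous_iff_continuousAt.2 fun t ↦ (hz t).continuousAt
  have hxi := integrableOn_mul_cexp_neg_of_tendsto_zero hxc hxl hs
  have hyi := integrableOn_mul_cexp_neg_of_tendsto_zero hyc hyl hs
  have hzi := integrableOn_mul_cexp_neg_of_tendsto_zero hzc hzl hs
  have hY := integral_deriv_mul_cexp_neg hx hyc hxl hyl hs
  have hZ := integral_deriv_mul_cexp_neg hy hzc hyl hzl hs
  have hW := integral_deriv_mul_cexp_neg hz (by fun_prop) hzl
    (by simpa using (((hzl.const_mul a).add (hyl.const_mul b)).add (hxl.const_mul c)).neg) hs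
  have hG : ∫ t in Ioi (0 : ℝ), ((τ * y t + x t : ℝ) : ℂ) * Complex.exp (-s * t) =
      τ * (∫ t in Ioi (0 : ℝ), (y t : ℂ) * Complex.exp (-s * t)) +
        ∫ t in Ioi (0 : ℝ), (x t : ℂ) * Complex.exp (-s * t) := by
    rw [← integral_const_mul, ← integral_add (hyi.const_mul _) hxi]
    congr with t
    push_cast
    ring
  have hW' : ∫ t in Ioi (0 : ℝ), ((-(a * z t + b * y t + c * x t) : ℝ) : ℂ) * Complex.exp (-s * t) =
      -(a * (∫ t in Ioi (0 : ℝ), (z t : ℂ) * Complex.exp (-s * t)) +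
        b * (∫ t in Ioi (0 : ℝ), (y t : ℂ) * Complex.exp (-s * t)) +
        c * ∫ t in Ioi (0 : ℝ), (x t : ℂ) * Complex.exp (-s * t)) := by
    rw [← integral_const_mul, ← integral_const_mul, ← integral_const_mul,
      ← integral_add (hzi.const_mul _) (hyi.const_mul _),
      ← integral_add ((hzi.const_mul _).fun_add (hyi.const_mul _)) (hxi.const_mul _), ← integral_neg]
    congr with t
    push_cast
    ring
  rw [hW', hZ, hY, hx0, hy0] at hW
  rw [hG, hY, hx0]
  push_cast at hW ⊢
  linear_combination -(τ * s + 1) * hW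

end ThirdOrder

/-- Injectivity of the Laplace transform on the half-plane `0 < re s`. -/
theorem ae_eq_of_forall_integral_mul_cexp_neg_eq {f g : ℝ → ℝ}
    (hf : ∀ s : ℂ, 0 < s.re →
      IntegrableOn (fun t : ℝ ↦ (f t : ℂ) * Complex.exp (-s * t)) (Ioi 0))
    (hg : ∀ s : ℂ, 0 < s.re →
      IntegrableOn (fun t : ℝ ↦ (g t : ℂ) * Complex.exp (-s * t)) (Ioi 0))
    (h : ∀ s : ℂ, 0 < s.re → ∫ t in Ioi (0 : ℝ), (f t : ℂ) * Complex.exp (-s * t) =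
      ∫ t in Ioi (0 : ℝ), (g t : ℂ) * Complex.exp (-s * t)) :
    f =ᵐ[volume.restrict (Ioi 0)] g := by
  have hint : IntegrableOn (fun t ↦ (f t - g t) * Real.exp (-t)) (Ioi 0) := by
    refine ((hf 1 (by simp)).sub (hg 1 (by simp))).re.congr (ae_of_all _ fun t ↦ ?_)
    have : ((f t : ℂ) * Complex.exp (-1 * t) - (g t : ℂ) * Complex.exp (-1 * t)) =
        (((f t - g t) * Real.exp (-t) : ℝ) : ℂ) := by
      push_cast
      ring_nf
    simp only [Pi.sub_apply, this]
    exact Complex.ofReal_re _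
  have key := ae_eq_zero_of_forall_integral_mul_exp_eq_zero hint fun ω ↦ ?_
  · filter_upwards [key] with t ht
    simpa [sub_eq_zero] using ht
  · have hs : 0 < (1 - ω * Complex.I : ℂ).re := by simp
    rw [← sub_eq_zero.2 (h _ hs), ← integral_sub (hf _ hs) (hg _ hs)]
    congr with t
    have : Complex.exp (-(1 - ω * Complex.I) * t) =
        Complex.exp (-t) * Complex.exp (ω * t * Complex.I) := by
      rw [← Complex.exp_add]
      ring_nf
    rw [this]
    push_cast
    ring

/-- The impulse response of `(τs+1)/(mτs³+(m+dτ)s²+(d+r⁻¹+λτ)s+λ)` (characterized by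
its Laplace transform) has squared L² norm
`(m+τ(λτ+d)) / (2λ[m(r⁻¹+d)+τd(r⁻¹+λτ+d)])`. -/
theorem stmt10 (m d rinv τ l : ℝ)
    (hm : 0 < m) (hd : 0 < d) (hr : 0 < rinv) (hτ : 0 < τ) (hl : 0 < l)
    (h : ℝ → ℝ) (hmeas : Measurable h)
    (hL2 : IntegrableOn (fun t => (h t) ^ 2) (Ioi 0))
    (hLapInt : ∀ s : ℂ, 0 < s.re →
      IntegrableOn (fun t : ℝ => (h t : ℂ) * Complex.exp (-s * t)) (Ioi 0))
    (hLap : ∀ s : ℂ, 0 < s.re →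
      ∫ t in Ioi (0 : ℝ), (h t : ℂ) * Complex.exp (-s * t) =
        (τ * s + 1) /
          (m * τ * s ^ 3 + (m + d * τ) * s ^ 2 + (d + rinv + l * τ) * s + l)) :
    ∫ t in Ioi (0 : ℝ), (h t) ^ 2 =
      (m + τ * (l * τ + d)) /
        (2 * l * (m * (rinv + d) + τ * d * (rinv + l * τ + d))) := by
  have hmτ : 0 < m * τ := by positivity
  have ha : 0 < (m + d * τ) / (m * τ) := by positivity
  have hb : 0 < (d + rinv + l * τ) / (m * τ) := by positivity
  have hc : 0 < l / (m * τ) := by positivity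
  have hab : l / (m * τ) < (m + d * τ) / (m * τ) * ((d + rinv + l * τ) / (m * τ)) := by
    rw [div_mul_div_comm, div_lt_div_iff₀ hmτ (by positivity)]
    have : 0 < m * τ * (m * (rinv + d) + τ * d * (rinv + l * τ + d)) := by positivity
    linarith
  obtain ⟨x, y, z, hx, hy, hz, hx0, hy0, hz0⟩ := exists_linear_ode_third_order
    ((m + d * τ) / (m * τ)) ((d + rinv + l * τ) / (m * τ)) (l / (m * τ)) 0 0 (1 / (m * τ))
  obtain ⟨hxl, hyl, -⟩ := tendsto_zero_of_third_order_hurwitz ha hb hc hab hx hy hz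
  have hxc : Continuous x := continuous_iff_continuousAt.2 fun t ↦ (hx t).continuousAt
  have hyc : Continuous y := continuous_iff_continuousAt.2 fun t ↦ (hy t).continuousAt
  have hae : h =ᵐ[volume.restrict (Ioi 0)] fun t ↦ τ * y t + x t := by
    refine ae_eq_of_forall_integral_mul_cexp_neg_eq hLapInt (fun s hs ↦
      integrableOn_mul_cexp_neg_of_tendsto_zero (by fun_prop)
        (by simpa using (hyl.const_mul τ).add hxl) hs) fun s hs ↦ ?_
    have hG := integral_mul_cexp_neg_third_order ha hb hc hab hx hy hz hx0 hy0 τ hs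
    have hX := integral_mul_cexp_neg_third_order ha hb hc hab hx hy hz hx0 hy0 0 hs
    have hm' : (m : ℂ) ≠ 0 := by exact_mod_cast hm.ne'
    have hτ' : (τ : ℂ) ≠ 0 := by exact_mod_cast hτ.ne'
    rw [hz0] at hG hX
    have hp : (m * τ * s ^ 3 + (m + d * τ) * s ^ 2 + (d + rinv + l * τ) * s + l : ℂ) =
        m * τ * (s ^ 3 + ((m + d * τ) / (m * τ) : ℝ) * s ^ 2 +
          ((d + rinv + l * τ) / (m * τ) : ℝ) * s + (l / (m * τ) : ℝ)) := by
      push_cast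
      field_simp
    have hp0 : (s ^ 3 + ((m + d * τ) / (m * τ) : ℝ) * s ^ 2 +
          ((d + rinv + l * τ) / (m * τ) : ℝ) * s + (l / (m * τ) : ℝ) : ℂ) ≠ 0 := by
      intro h0
      rw [h0] at hX
      simp [hm', hτ'] at hX
    rw [hLap s hs, hp, div_eq_iff (mul_ne_zero (mul_ne_zero hm' hτ') hp0)]
    push_cast at hG ⊢
    rw [mul_left_comm, hG]
    field_simp
  have hsq : ∫ t in Ioi (0 : ℝ), h t ^ 2 = ∫ t in Ioi (0 : ℝ), (τ * y t + x t) ^ 2 :=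
    integral_congr_ae (hae.mono fun t ht ↦ by simp only [ht])
  rw [hsq, integral_sq_third_order ha hb hc hab hx hy hz hx0 hy0 τ, hz0]
  have hD : (m + d * τ) / (m * τ) * ((d + rinv + l * τ) / (m * τ)) - l / (m * τ) =
      (m * (rinv + d) + τ * d * (rinv + l * τ + d)) / (m * τ) ^ 2 := by
    field_simp
    ring
  rw [hD]
  field_simp
  ring
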